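/- Let Γ be a finitely generated subgroup of PSL(2, ℝ). Then the set of angles θ ∈ (0, 2π) such that θ is a rational multiple of π and θ is the rotation angle of some element of Γ is finite. -/

import Mathlib

open Matrix Real

/-- The rotation matrix `R(φ) = [[cos φ, sin φ], [-sin φ, cos φ]]` as an element of `SL(2, ℝ)`. -/
noncomputable def rotSL (φ : ℝ) : SpecialLinearGroup (Fin 2) ℝ :=
  ⟨!![Real.cos φ, Real.sin φ; -Real.sin φ, Real.cos φ], by
    rw [Matrix.det_fin_two_of]
    nlinarith [Real.sin_sq_add_cos_sq φ]⟩

/-- `PSL(2, ℝ)`: the quotient of `SL(2, ℝ)` by its center `{I, -I}`. -/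
abbrev PSL2R : Type :=
  SpecialLinearGroup (Fin 2) ℝ ⧸ Subgroup.center (SpecialLinearGroup (Fin 2) ℝ)

theorem aux_dvd_factorial {n N : ℕ} (hn : 0 < n) (h : Nat.totient n ≤ N) :
    n ∣ Nat.factorial (2 * N) := by
  rw [Nat.dvd_iff_prime_pow_dvd_dvd]
  intro p k hp hk
  rcases Nat.eq_zero_or_pos k with rfl | hk0
  · simp
  have h1 : Nat.totient (p ^ k) ≤ N :=
    (Nat.le_of_dvd (Nat.totient_pos.2 hn) (Nat.totient_dvd_of_dvd hk)).trans h
  obtain ⟨m, rfl⟩ := Nat.exists_eq_add_of_lt hk0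
  apply Nat.dvd_factorial (pow_pos hp.pos _)
  simp only [zero_add] at h1 ⊢
  rw [Nat.totient_prime_pow_succ hp] at h1
  have h2 := hp.two_le
  have h3 : p ≤ 2 * (p - 1) := by omega
  calc p ^ (m + 1) = p ^ m * p := pow_succ _ _
    _ ≤ p ^ m * (2 * (p - 1)) := Nat.mul_le_mul_left _ h3
    _ = 2 * (p ^ m * (p - 1)) := by ring
    _ ≤ 2 * N := by omega

theorem aux_degree_bound (B : Subalgebra ℚ ℝ) (hB : B.FG) :
    ∃ d : ℕ, ∀ x ∈ B, IsIntegral ℚ x → (minpoly ℚ x).natDegree ≤ d := by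
  have : Algebra.FiniteType ℚ B := B.fg_iff_finiteType.1 hB
  obtain ⟨m, hm⟩ := Ideal.exists_maximal B
  let _ := Ideal.Quotient.field m
  have : Module.Finite ℚ (B ⧸ m) := finite_of_finite_type_of_isJacobsonRing ℚ (B ⧸ m)
  refine ⟨Module.finrank ℚ (B ⧸ m), fun x hx hi => ?_⟩
  have h0 : Polynomial.aeval (⟨x, hx⟩ : B) (minpoly ℚ x) = 0 := by
    apply Subtype.ext
    have := minpoly.aeval ℚ x
    have h2 := Polynomial.aeval_algHom_apply B.val ⟨x, hx⟩ (minpoly ℚ x)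
    exact h2.symm.trans this
  have h1 : Polynomial.aeval (Ideal.Quotient.mkₐ ℚ m ⟨x, hx⟩) (minpoly ℚ x) = 0 := by
    rw [Polynomial.aeval_algHom_apply, h0, map_zero]
  rw [minpoly.eq_of_irreducible_of_monic (minpoly.irreducible hi) h1 (minpoly.monic hi)]
  have : Module.Free ℚ (B ⧸ m) := Module.Free.of_divisionRing ℚ (B ⧸ m)
  exact minpoly.natDegree_le _

theorem aux_root (d : ℕ) (q : ℚ) (φ : ℝ) (hφ : φ = q * Real.pi)
    (hd : IsIntegral ℚ (2 * Real.cos φ) → (minpoly ℚ (2 * Real.cos φ)).natDegree ≤ d) :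
    Complex.exp (φ * Complex.I) ^ (Nat.factorial (2 * (d * 2))) = 1 := by
  set ζ := Complex.exp (φ * Complex.I) with hζ
  have hfin : ζ ^ (2 * q.den) = 1 := by
    rw [hζ, ← Complex.exp_nat_mul, Complex.exp_eq_one_iff]
    refine ⟨q.num, ?_⟩
    have : (q.den : ℂ) * (q : ℂ) = q.num := by exact_mod_cast Rat.den_mul_eq_num q
    rw [hφ]
    push_cast
    linear_combination (2 * Real.pi * Complex.I : ℂ) * this
  have hof : IsOfFinOrder ζ := isOfFinOrder_iff_pow_eq_one.2 ⟨2 * q.den, by have := q.den_pos; omega, hfin⟩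
  have hpos := hof.orderOf_pos
  have hprim := IsPrimitiveRoot.orderOf ζ
  have hζi : IsIntegral ℚ ζ := (hprim.isIntegral hpos).tower_top
  have hne : ζ ≠ 0 := Complex.exp_ne_zero _
  have hc : ((2 * Real.cos φ : ℝ) : ℂ) = ζ + ζ⁻¹ := by
    push_cast
    rw [Complex.cos, hζ, ← Complex.exp_neg]
    ring_nf
  have hci : IsIntegral ℚ ((2 * Real.cos φ : ℝ) : ℂ) := by
    rw [hc]; exact hζi.add hζi.inv
  have hmp : minpoly ℚ ((2 * Real.cos φ : ℝ) : ℂ) = minpoly ℚ (2 * Real.cos φ) :=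
    minpoly.algebraMap_eq (algebraMap ℝ ℂ).injective _
  have hci' : IsIntegral ℚ (2 * Real.cos φ) :=
    (isIntegral_algebraMap_iff (algebraMap ℝ ℂ).injective).1 hci
  have hd' := hd hci'
  rw [← hmp, ← IntermediateField.adjoin.finrank hci] at hd'
  set c := ((2 * Real.cos φ : ℝ) : ℂ) with hcdef
  let E := IntermediateField.adjoin ℚ {c}
  have : FiniteDimensional ℚ E := IntermediateField.adjoin.finiteDimensional hci
  have hcE : c ∈ E := IntermediateField.mem_adjoin_simple_self ℚ c
  let P : Polynomial E := Polynomial.X ^ 2 - Polynomial.C ⟨c, hcE⟩ * Polynomial.X + 1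
  have hPd : P.natDegree = 2 := by simp only [P]; compute_degree!
  have hP0 : P ≠ 0 := by intro h; rw [h] at hPd; simp at hPd
  have hPz : Polynomial.aeval ζ P = 0 := by
    simp only [P, map_add, map_sub, map_mul, map_pow, Polynomial.aeval_X, Polynomial.aeval_C, map_one]
    have : algebraMap E ℂ ⟨c, hcE⟩ = ζ + ζ⁻¹ := hc
    rw [this]; field_simp; ring
  have hdeg : (minpoly E ζ).natDegree ≤ 2 := by
    rw [← hPd]; exact Polynomial.natDegree_le_natDegree (minpoly.degree_le_of_ne_zero E ζ hP0 hPz)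
  have hζE : IsIntegral E ζ := hζi.tower_top
  have : FiniteDimensional E (IntermediateField.adjoin E {ζ}) :=
    IntermediateField.adjoin.finiteDimensional hζE
  have : FiniteDimensional ℚ (IntermediateField.adjoin E {ζ}) := FiniteDimensional.trans ℚ E _
  have hfr := Module.finrank_mul_finrank ℚ E (IntermediateField.adjoin E {ζ})
  rw [IntermediateField.adjoin.finrank hζE] at hfr
  have h4 := minpoly.natDegree_le (A := ℚ) (IntermediateField.AdjoinSimple.gen E ζ)
  have h5 : minpoly ℚ (IntermediateField.AdjoinSimple.gen E ζ) = minpoly ℚ ζ :=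
    (minpoly.algebraMap_eq (B' := ℂ)
      (algebraMap (IntermediateField.adjoin E {ζ}) ℂ).injective _).symm
  rw [h5, ← Polynomial.cyclotomic_eq_minpoly_rat hprim hpos, Polynomial.natDegree_cyclotomic, ← hfr] at h4
  have h6 := h4.trans (Nat.mul_le_mul hd' hdeg)
  exact orderOf_dvd_iff_pow_eq_one.1 (aux_dvd_factorial hpos h6)

theorem aux_center {z : SpecialLinearGroup (Fin 2) ℝ} (hz : z ∈ Subgroup.center _) :
    z.1 = 1 ∨ z.1 = -1 := by
  rw [Matrix.SpecialLinearGroup.mem_center_iff] at hz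
  obtain ⟨r, hr, h⟩ := hz
  rw [← h]
  simp only [Fintype.card_fin, sq_eq_one_iff] at hr
  rcases hr with rfl | rfl
  · simp
  · right; rw [map_neg, map_one]

theorem aux_entries (Γ : Subgroup PSL2R) (hΓ : Group.FG Γ) :
    ∃ B : Subalgebra ℚ ℝ, B.FG ∧ ∀ h : SpecialLinearGroup (Fin 2) ℝ,
      (QuotientGroup.mk h : PSL2R) ∈ Γ → ∀ i j, h.1 i j ∈ B := by
  obtain ⟨S, hS⟩ := (Group.fg_iff_subgroup_fg Γ).1 hΓ
  let E : Set ℝ := ⋃ s ∈ S, Set.range fun p : Fin 2 × Fin 2 => (Quotient.out s).1 p.1 p.2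
  have hE : E.Finite := S.finite_toSet.biUnion fun s _ => Set.finite_range _
  let B := Algebra.adjoin ℚ E
  refine ⟨B, Subalgebra.fg_def.2 ⟨E, hE, rfl⟩, fun h hh i j => ?_⟩
  let T : Subgroup (Matrix.SpecialLinearGroup (Fin 2) ℝ) :=
    (Matrix.SpecialLinearGroup.map (n := Fin 2) (B.val : B →+* ℝ)).range
  have hle : Γ ≤ T.map (QuotientGroup.mk' (Subgroup.center _)) := by
    rw [← hS, Subgroup.closure_le]
    intro s hs
    have hmem : ∀ i j, (Quotient.out s).1 i j ∈ B := fun i j =>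
      Algebra.subset_adjoin (Set.mem_biUnion hs ⟨(i, j), rfl⟩)
    refine ⟨Quotient.out s, ⟨⟨Matrix.of fun i j => ⟨_, hmem i j⟩, ?_⟩, ?_⟩, Quotient.out_eq s⟩
    · apply Subtype.ext
      have := (Quotient.out s).2
      rw [Matrix.det_fin_two] at this ⊢
      simpa using this
    · ext i j
      rfl
  obtain ⟨t, ⟨t', rfl⟩, ht⟩ := hle hh
  have hz := QuotientGroup.eq.1 ht
  have hB : ∀ i j, (Matrix.SpecialLinearGroup.map (n := Fin 2) (B.val : B →+* ℝ) t').1 i j ∈ B :=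
    fun i j => (t'.1 i j).2
  set t := Matrix.SpecialLinearGroup.map (n := Fin 2) (B.val : B →+* ℝ) t'
  have hht : h.1 = t.1 * (t⁻¹ * h).1 := by
    rw [← Matrix.SpecialLinearGroup.coe_mul, mul_inv_cancel_left]
  rw [hht]
  rcases aux_center hz with h1 | h1
  · rw [h1, mul_one]; exact hB i j
  · rw [h1, mul_neg, mul_one]; exact B.neg_mem (hB i j)

/-- **Finitely many rational rotation angles.** For a finitely generated subgroup `Γ` of
`PSL(2, ℝ)`, only finitely many angles `θ ∈ (0, 2π)` that are rational multiples of `π` occur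
as rotation angles of elements of `Γ` (an element has rotation angle `θ` if it is conjugate in
`PSL(2, ℝ)` to the image of `R(θ/2)`). -/
theorem finitely_many_rational_rotation_angles (Γ : Subgroup PSL2R) (hΓ : Group.FG Γ) :
    {θ : ℝ | θ ∈ Set.Ioo 0 (2 * Real.pi) ∧ (∃ q : ℚ, θ = q * Real.pi) ∧
      ∃ g ∈ Γ, IsConj (QuotientGroup.mk (rotSL (θ / 2)) : PSL2R) g}.Finite := by
  obtain ⟨B, hB, hent⟩ := aux_entries Γ hΓ
  obtain ⟨d, hd⟩ := aux_degree_bound B hB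
  set M := Nat.factorial (2 * (d * 2)) with hM
  have hMpos : 0 < M := Nat.factorial_pos _
  have hfin : {z : ℂ | z ^ M = 1}.Finite := by
    refine (Polynomial.nthRootsFinset M (1 : ℂ)).finite_toSet.subset fun z hz => ?_
    simpa [Polynomial.mem_nthRootsFinset hMpos] using hz
  refine Set.Finite.of_finite_image (f := fun θ : ℝ => Complex.exp ((θ / 2 : ℝ) * Complex.I))
    (hfin.subset ?_) ?_
  · rintro _ ⟨θ, ⟨hθ, ⟨q, hq⟩, g, hg, hconj⟩, rfl⟩
    refine aux_root d (q / 2) (θ / 2) (by rw [hq]; push_cast; ring) fun hi => hd _ ?_ hi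
    obtain ⟨u, hu⟩ := isConj_iff.1 hconj
    obtain ⟨U, rfl⟩ := QuotientGroup.mk_surjective u
    have hmem : (QuotientGroup.mk (U * rotSL (θ / 2) * U⁻¹) : PSL2R) ∈ Γ := by
      rw [← hu] at hg; exact hg
    have h1 := B.add_mem (hent _ hmem 0 0) (hent _ hmem 1 1)
    have h2 : Matrix.trace (U * rotSL (θ / 2) * U⁻¹).1 = 2 * Real.cos (θ / 2) := by
      rw [Matrix.SpecialLinearGroup.coe_mul, Matrix.trace_mul_comm, ← Matrix.SpecialLinearGroup.coe_mul,
        inv_mul_cancel_left]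
      simp [rotSL, Matrix.trace_fin_two]
      ring
    rw [Matrix.trace_fin_two] at h2
    rwa [h2] at h1
  · rintro a ⟨ha, -⟩ b ⟨hb, -⟩ hab
    have := congrArg Complex.re hab
    simp only [Complex.exp_ofReal_mul_I_re] at this
    have := Real.injOn_cos (by constructor <;> linarith [ha.1, ha.2])
      (by constructor <;> linarith [hb.1, hb.2]) this
    linarith
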